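/- arXiv:2603.23369 — 2 statements merged into one kernel-verified Lean document; each statement's English description precedes it below -/
import Mathlib

section
/- Let (X,d_X) and (Y,d_Y) be metric spaces, each with at least two points, let k > 0, and let T : LPM_k(X,d_X) → LPM_k(Y,d_Y) be a bijective sup-metric isometry. Then T is scalar-preserving: for every d ∈ LPM_k(X,d_X) and every real t ≥ 0 such that t·d ∈ LPM_k(X,d_X), one has T(t·d) = t·T(d). -/
open Set Filter

namespace BanachStone

/-- `d` is a pseudometric. -/
def IsPseudometric {Z : Type*} (d : Z → Z → ℝ) : Prop :=
  (∀ z, d z z = 0) ∧ (∀ z w, d z w = d w z) ∧ (∀ z w v, d z v ≤ d z w + d w v)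

/-- `d` is bounded. -/
def IsBoundedPM {Z : Type*} (d : Z → Z → ℝ) : Prop := ∃ C : ℝ, ∀ z w, d z w ≤ C

/-- The sup-norm of `d`. -/
noncomputable def supNorm {Z : Type*} (d : Z → Z → ℝ) : ℝ := ⨆ p : Z × Z, d p.1 p.2

/-- The sup-metric between `d` and `ρ`. -/
noncomputable def supDist {Z : Type*} (d ρ : Z → Z → ℝ) : ℝ :=
  ⨆ p : Z × Z, |d p.1 p.2 - ρ p.1 p.2|

/-- `PM Z`: bounded continuous pseudometrics on `Z`. -/
def PM (Z : Type*) [TopologicalSpace Z] : Set (Z → Z → ℝ) :=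
  {d | IsPseudometric d ∧ IsBoundedPM d ∧ Continuous fun p : Z × Z => d p.1 p.2}

/-- The topology induced by `d` (generated by open `d`-balls). -/
def metricTopology {Z : Type*} (d : Z → Z → ℝ) : TopologicalSpace Z :=
  TopologicalSpace.generateFrom {s | ∃ z : Z, ∃ r : ℝ, s = {w | d z w < r}}

/-- `AM Z`: admissible metrics, i.e. bounded metrics inducing the topology of `Z`. -/
def AM (Z : Type*) [t : TopologicalSpace Z] : Set (Z → Z → ℝ) :=
  {d | IsPseudometric d ∧ IsBoundedPM d ∧ (∀ z w : Z, z ≠ w → 0 < d z w) ∧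
    metricTopology d = t}

/-- `Pp Z`: elements of `PM Z` attaining the sup-norm at exactly one unordered pair
of distinct points. -/
def Pp (Z : Type*) [TopologicalSpace Z] : Set (Z → Z → ℝ) :=
  {d | d ∈ PM Z ∧ ∃ z w : Z, z ≠ w ∧ d z w = supNorm d ∧
    ∀ z' w' : Z, z' ≠ w' → d z' w' = supNorm d → ({z', w'} : Set Z) = {z, w}}

/-- `UPM Z`: bounded pseudometrics uniformly continuous w.r.t. the uniformity of `Z`. -/
def UPM (Z : Type*) [UniformSpace Z] : Set (Z → Z → ℝ) :=
  {d | IsPseudometric d ∧ IsBoundedPM d ∧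
    ∀ ε : ℝ, 0 < ε → ∃ U ∈ uniformity Z, ∀ x y : Z, (x, y) ∈ U → d x y < ε}

/-- `UC Z`: bounded uniformly continuous real-valued functions on `Z`. -/
def UC (Z : Type*) [UniformSpace Z] : Set (Z → ℝ) :=
  {f | (∃ C : ℝ, ∀ z, |f z| ≤ C) ∧ UniformContinuous f}

/-- The space `U(Z)`. -/
def Ucal (Z : Type*) [UniformSpace Z] : Set (Z → Z → ℝ) :=
  {d | d ∈ PM Z ∧ ∀ ε : ℝ, 0 < ε → ∃ F : Finset (Z → ℝ), F.Nonempty ∧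
    (↑F : Set (Z → ℝ)) ⊆ UC Z ∧ ∃ δ : ℝ, 0 < δ ∧
    ∀ x y : Z, (∀ f ∈ F, |f x - f y| < δ) → d x y < ε}

/-- The uniformity filter of the coarsest uniformity on `Z` making every bounded
uniformly continuous real-valued function on `Z` uniformly continuous. -/
noncomputable def U0 (Z : Type*) [UniformSpace Z] : Filter (Z × Z) :=
  ⨅ f ∈ UC Z, Filter.comap (fun p : Z × Z => (f p.1, f p.2)) (uniformity ℝ)

/-- The Lipschitz constant of a pseudometric on a metric space. -/
noncomputable def lip {Z : Type*} [PseudoMetricSpace Z] (d : Z → Z → ℝ) : ENNReal :=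
  ⨆ (x : Z) (y : Z) (_ : x ≠ y), ENNReal.ofReal (d x y / dist x y)

/-- `LPM Z`: bounded Lipschitz continuous pseudometrics on `Z`. -/
def LPM (Z : Type*) [MetricSpace Z] : Set (Z → Z → ℝ) :=
  {d | IsPseudometric d ∧ IsBoundedPM d ∧ lip d < ⊤}

/-- `LPM_k Z`: elements of `LPM Z` with Lipschitz constant `< k`. -/
def LPMlt (k : ℝ) (Z : Type*) [MetricSpace Z] : Set (Z → Z → ℝ) :=
  {d | d ∈ LPM Z ∧ lip d < ENNReal.ofReal k}

/-- `\overline{LPM}_k Z`: elements of `LPM Z` with Lipschitz constant `≤ k`. -/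
def LPMle (k : ℝ) (Z : Type*) [MetricSpace Z] : Set (Z → Z → ℝ) :=
  {d | d ∈ LPM Z ∧ lip d ≤ ENNReal.ofReal k}

/-- `Z` has exactly two points. -/
def ExactlyTwo (Z : Type*) : Prop := ∃ a b : Z, a ≠ b ∧ ∀ c : Z, c = a ∨ c = b

/-- The two-element subsets of `Z`. -/
def Dset (Z : Type*) : Set (Set Z) := {s | ∃ a b : Z, a ≠ b ∧ s = {a, b}}

section Basic

variable {Z : Type*}

lemma IsPseudometric.nonneg {d : Z → Z → ℝ} (hd : IsPseudometric d) (x y : Z) : 0 ≤ d x y := by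
  have h1 := hd.2.2 x y x
  have h2 := hd.1 x
  have h3 := hd.2.1 x y
  linarith

lemma IsPseudometric.max {d e : Z → Z → ℝ} (hd : IsPseudometric d) (he : IsPseudometric e) :
    IsPseudometric fun x y => max (d x y) (e x y) := by
  refine ⟨fun z => by simp [hd.1, he.1], fun z w => by simp only [hd.2.1 z w, he.2.1 z w],
    fun z w v => max_le ?_ ?_⟩
  · exact (hd.2.2 z w v).trans (add_le_add (le_max_left _ _) (le_max_left _ _))
  · exact (he.2.2 z w v).trans (add_le_add (le_max_right _ _) (le_max_right _ _))

lemma isPseudometric_abs_sub (h : Z → ℝ) : IsPseudometric fun x y => |h x - h y| :=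
  ⟨fun _ => by simp, fun _ _ => abs_sub_comm _ _, fun _ _ _ => abs_sub_le _ _ _⟩

/-- A pseudometric dominated by `K * dist` varies by at most `K` times the displacement of its
arguments. -/
lemma IsPseudometric.abs_sub_le_mul_dist [MetricSpace Z] {d : Z → Z → ℝ} (hd : IsPseudometric d)
    {K : ℝ} (hK : ∀ x y, d x y ≤ K * dist x y) (x y a b : Z) :
    |d x y - d a b| ≤ K * dist x a + K * dist y b := by
  have h1 := hd.2.2 x a y
  have h2 := hd.2.2 a b y
  have h3 := hd.2.2 a x b
  have h4 := hd.2.2 x y b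
  have h5 := hd.2.1 a x
  have h6 := hd.2.1 b y
  have h7 := hK x a
  have h8 := hK y b
  rw [abs_le]
  constructor <;> linarith

lemma mem_LPMlt_iff [MetricSpace Z] {k : ℝ} (hk : 0 < k) {d : Z → Z → ℝ} :
    d ∈ LPMlt k Z ↔ IsPseudometric d ∧ IsBoundedPM d ∧
      ∃ L : ℝ, 0 ≤ L ∧ L < k ∧ ∀ x y, d x y ≤ L * dist x y := by
  constructor
  · rintro ⟨⟨hd, hb, hlip⟩, hlt⟩
    refine ⟨hd, hb, (lip d).toReal, ENNReal.toReal_nonneg, ?_, fun x y => ?_⟩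
    · rwa [← ENNReal.ofReal_toReal hlip.ne, ENNReal.ofReal_lt_ofReal_iff hk] at hlt
    · rcases eq_or_ne x y with rfl | hxy
      · simp [hd.1]
      · have h : ENNReal.ofReal (d x y / dist x y) ≤ lip d :=
          le_iSup_of_le x (le_iSup_of_le y (le_iSup_of_le hxy le_rfl))
        rw [← div_le_iff₀ (dist_pos.2 hxy)]
        exact (ENNReal.ofReal_le_iff_le_toReal hlip.ne).1 h
  · rintro ⟨hd, hb, L, hL, hLk, h⟩
    have hle : lip d ≤ ENNReal.ofReal L := by
      refine iSup_le fun x => iSup_le fun y => iSup_le fun hxy => ENNReal.ofReal_le_ofReal ?_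
      rw [div_le_iff₀ (dist_pos.2 hxy)]
      exact h x y
    exact ⟨⟨hd, hb, hle.trans_lt ENNReal.ofReal_lt_top⟩,
      hle.trans_lt ((ENNReal.ofReal_lt_ofReal_iff hk).2 hLk)⟩

lemma zero_mem_LPMlt [MetricSpace Z] {k : ℝ} (hk : 0 < k) :
    (fun _ _ => 0 : Z → Z → ℝ) ∈ LPMlt k Z :=
  (mem_LPMlt_iff hk).2 ⟨⟨by simp, by simp, by simp⟩, ⟨0, by simp⟩, 0, le_rfl, hk, by simp⟩

lemma IsPseudometric.const_mul {d : Z → Z → ℝ} (hd : IsPseudometric d) {t : ℝ} (ht : 0 ≤ t) :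
    IsPseudometric fun x y => t * d x y :=
  ⟨fun z => by simp [hd.1], fun z w => by simp only [hd.2.1 z w], fun z w v => by
    have := mul_le_mul_of_nonneg_left (hd.2.2 z w v) ht
    simpa only [mul_add] using this⟩

lemma IsBoundedPM.const_mul {d : Z → Z → ℝ} (hd : IsBoundedPM d) {t : ℝ} (ht : 0 ≤ t) :
    IsBoundedPM fun x y => t * d x y := by
  obtain ⟨C, hC⟩ := hd
  exact ⟨t * C, fun z w => mul_le_mul_of_nonneg_left (hC z w) ht⟩

lemma const_mul_mem_LPMlt [MetricSpace Z] {k : ℝ} (hk : 0 < k) {d : Z → Z → ℝ}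
    (hd : d ∈ LPMlt k Z) {t : ℝ} (ht : 0 ≤ t) (ht1 : t ≤ 1) :
    (fun x y => t * d x y) ∈ LPMlt k Z := by
  obtain ⟨hp, hb, L, hL, hLk, h⟩ := (mem_LPMlt_iff hk).1 hd
  refine (mem_LPMlt_iff hk).2 ⟨hp.const_mul ht, hb.const_mul ht, L, hL, hLk, fun x y => ?_⟩
  exact (mul_le_of_le_one_left (hp.nonneg x y) ht1).trans (h x y)

lemma exists_one_add_mul_mem_LPMlt [MetricSpace Z] {k : ℝ} (hk : 0 < k) {d : Z → Z → ℝ}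
    (hd : d ∈ LPMlt k Z) :
    ∃ ε : ℝ, 0 < ε ∧ ε ≤ 1 ∧ (fun x y => (1 + ε) * d x y) ∈ LPMlt k Z := by
  obtain ⟨hp, hb, L, hL, hLk, h⟩ := (mem_LPMlt_iff hk).1 hd
  have hpos : 0 < (k - L) / (2 * k) := div_pos (by linarith) (by linarith)
  have hε : (k - L) / (2 * k) * (2 * k) = k - L := div_mul_cancel₀ _ (by positivity)
  set ε := (k - L) / (2 * k)
  refine ⟨ε, hpos, by nlinarith, (mem_LPMlt_iff hk).2 ⟨hp.const_mul (by linarith),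
    hb.const_mul (by linarith), (1 + ε) * L, by positivity, by nlinarith, fun x y => ?_⟩⟩
  have := mul_le_mul_of_nonneg_left (h x y) (by linarith : 0 ≤ 1 + ε)
  linarith

lemma LPMlt_le_mul_dist [MetricSpace Z] {k : ℝ} (hk : 0 < k) {d : Z → Z → ℝ}
    (hd : d ∈ LPMlt k Z) (x y : Z) : d x y ≤ k * dist x y := by
  obtain ⟨-, -, L, -, hLk, h⟩ := (mem_LPMlt_iff hk).1 hd
  exact (h x y).trans (mul_le_mul_of_nonneg_right hLk.le dist_nonneg)

/-- Two elements of `LPMlt k Z` share a Lipschitz bound, arbitrarily close to `k`. -/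
lemma exists_common_lip [MetricSpace Z] {k : ℝ} (hk : 0 < k) {d e : Z → Z → ℝ}
    (hd : d ∈ LPMlt k Z) (he : e ∈ LPMlt k Z) {K₀ : ℝ} (hK₀ : K₀ < k) :
    ∃ K : ℝ, K₀ ≤ K ∧ 0 ≤ K ∧ K < k ∧ (∀ x y, d x y ≤ K * dist x y) ∧
      ∀ x y, e x y ≤ K * dist x y := by
  obtain ⟨-, -, L, hL, hLk, h⟩ := (mem_LPMlt_iff hk).1 hd
  obtain ⟨-, -, M, hM, hMk, h'⟩ := (mem_LPMlt_iff hk).1 he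
  refine ⟨max K₀ (max L M), le_max_left _ _, le_max_of_le_right (le_max_of_le_left hL),
    max_lt hK₀ (max_lt hLk hMk), fun x y => (h x y).trans ?_, fun x y => (h' x y).trans ?_⟩
  · exact mul_le_mul_of_nonneg_right (le_max_of_le_right (le_max_left _ _)) dist_nonneg
  · exact mul_le_mul_of_nonneg_right (le_max_of_le_right (le_max_right _ _)) dist_nonneg

lemma abs_sub_le_supDist {d e : Z → Z → ℝ} (hd : IsPseudometric d) (hdb : IsBoundedPM d)
    (he : IsPseudometric e) (heb : IsBoundedPM e) (x y : Z) :
    |d x y - e x y| ≤ supDist d e := by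
  obtain ⟨C, hC⟩ := hdb
  obtain ⟨M, hM⟩ := heb
  refine le_ciSup (f := fun p : Z × Z => |d p.1 p.2 - e p.1 p.2|) ⟨C + M, ?_⟩ (x, y)
  rintro _ ⟨⟨z, w⟩, rfl⟩
  have h1 := hd.nonneg z w
  have h2 := he.nonneg z w
  have h3 := hC z w
  have h4 := hM z w
  simp only [abs_le]
  constructor <;> linarith

lemma abs_sub_le_supDist_of_mem [MetricSpace Z] {k : ℝ} {d e : Z → Z → ℝ}
    (hd : d ∈ LPMlt k Z) (he : e ∈ LPMlt k Z) (x y : Z) : |d x y - e x y| ≤ supDist d e :=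
  abs_sub_le_supDist hd.1.1 hd.1.2.1 he.1.1 he.1.2.1 x y

lemma supDist_le [Nonempty Z] {d e : Z → Z → ℝ} {c : ℝ} (h : ∀ x y, |d x y - e x y| ≤ c) :
    supDist d e ≤ c :=
  ciSup_le fun p => h p.1 p.2

lemma exists_lt_abs_sub [Nonempty Z] {d e : Z → Z → ℝ} {c : ℝ} (h : c < supDist d e) :
    ∃ x y, c < |d x y - e x y| := by
  obtain ⟨p, hp⟩ := exists_lt_of_lt_ciSup h
  exact ⟨p.1, p.2, hp⟩

/-- Every `D` can be raised by `δ` at a given pair `(a, b)` by an `F` having there a conical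
peak of slope `K` relative to `D`. -/
lemma exists_peak [MetricSpace Z] {k K δ : ℝ} (hK : 0 ≤ K) (hKk : K < k) (hδ : 0 < δ)
    {D : Z → Z → ℝ} (hD : IsPseudometric D) (hDb : IsBoundedPM D)
    (hDK : ∀ x y, D x y ≤ K * dist x y) {a b : Z} (hab : D a b + δ ≤ K * dist a b) :
    ∃ F ∈ LPMlt k Z, (∀ x y, D x y ≤ F x y) ∧ (∀ x y, F x y ≤ D x y + δ) ∧
      F a b = D a b + δ ∧
      ∀ x y, δ / 2 < F x y - D x y → ∀ D' : Z → Z → ℝ, IsPseudometric D' →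
        (∀ x y, D' x y ≤ K * dist x y) → |D' x y - D' a b| ≤ F a b - F x y := by
  set h : Z → ℝ := fun x =>
    min (max (D x b) (D a b + δ / 2 - K * dist x a)) (-(δ / 2) + K * dist x b) with hh
  have hup (x : Z) : h x ≤ D x b + δ / 2 := by
    refine (min_le_left _ _).trans (max_le (by linarith) ?_)
    have h1 := hD.2.2 a x b
    have h2 := hDK a x
    rw [dist_comm] at h2
    linarith
  have hlo (x : Z) : D x b - δ / 2 ≤ h x := by
    refine le_min ((by linarith : D x b - δ / 2 ≤ D x b).trans (le_max_left _ _)) ?_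
    linarith [hDK x b]
  have hlip (x y : Z) : h x - h y ≤ K * dist x y := by
    have e1 : D x b ≤ D y b + K * dist x y := by linarith [hD.2.2 x y b, hDK x y]
    have e2 : K * dist y a ≤ K * dist x a + K * dist x y := by
      have := dist_triangle_left y a x
      rw [← mul_add]
      exact mul_le_mul_of_nonneg_left (by linarith) hK
    have e3 : K * dist x b ≤ K * dist y b + K * dist x y := by
      have := dist_triangle x y b
      rw [← mul_add]
      exact mul_le_mul_of_nonneg_left (by linarith) hK
    have : h x ≤ h y + K * dist x y := by
      simp only [hh]
      rw [← min_add_add_right, ← max_add_add_right]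
      exact min_le_min (max_le_max e1 (by linarith)) (by linarith)
    linarith
  have hdiff (x y : Z) : h x - h y ≤ D x y + δ := by
    linarith [hup x, hlo y, hD.2.2 x y b]
  have hle (x y : Z) : |h x - h y| ≤ D x y + δ :=
    abs_le.2 ⟨by linarith [hdiff y x, hD.2.1 x y], hdiff x y⟩
  have ha : h a = D a b + δ / 2 := by
    simp only [hh, dist_self, mul_zero, sub_zero]
    rw [max_eq_right (by linarith), min_eq_left (by linarith)]
  have hb : h b = -(δ / 2) := by
    simp only [hh, dist_self, mul_zero, add_zero, hD.1]
    exact min_eq_right ((by linarith : -(δ / 2) ≤ 0).trans (le_max_left _ _))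
  have hF : max (D a b) |h a - h b| = D a b + δ := by
    rw [ha, hb, abs_of_nonneg (by linarith [hD.nonneg a b]), max_eq_right (by linarith)]
    ring
  have cone (x y : Z) (hxy : D x y + δ / 2 < h x - h y) :
      h x - h y ≤ D a b + δ - (K * dist x a + K * dist y b) := by
    have t := hD.2.2 x y b
    have h1 : D x b < h x := by linarith [hlo y]
    have h2 : h y < D y b := by linarith [hup x]
    have h3 : h x ≤ D a b + δ / 2 - K * dist x a := by
      rcases le_max_iff.1 (min_le_left _ _ : h x ≤ max (D x b) _) with h | h
      · linarith
      · exact h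
    have h4 : -(δ / 2) + K * dist y b ≤ h y := by
      rcases min_le_iff.1 (le_refl (h y)) with h | h
      · linarith [(le_max_left _ _).trans h]
      · exact h
    linarith
  obtain ⟨C, hC⟩ := hDb
  have hmem : (fun x y => max (D x y) |h x - h y|) ∈ LPMlt k Z := by
    refine (mem_LPMlt_iff (hK.trans_lt hKk)).2 ⟨hD.max (isPseudometric_abs_sub h),
      ⟨C + δ, fun x y => ?_⟩, K, hK, hKk, fun x y => max_le (hDK x y) (abs_le.2 ⟨?_, hlip x y⟩)⟩
    · exact max_le (by linarith [hC x y]) ((hle x y).trans (by linarith [hC x y]))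
    · have := hlip y x
      rw [dist_comm] at this
      linarith
  refine ⟨_, hmem, fun x y => le_max_left _ _, fun x y => max_le (by linarith) (hle x y), hF, ?_⟩
  intro x y hxy D' hD' hD'K
  rw [hF]
  have hlt : D x y + δ / 2 < |h x - h y| := by
    rcases max_cases (D x y) |h x - h y| with ⟨h1, -⟩ | ⟨h1, -⟩ <;> rw [h1] at hxy <;> linarith
  rw [max_eq_right (by linarith)]
  rcases abs_cases (h x - h y) with ⟨h1, -⟩ | ⟨h1, -⟩ <;> rw [h1] at hlt ⊢
  · linarith [cone x y hlt, hD'.abs_sub_le_mul_dist hD'K x y a b]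
  · have h2 := cone y x (by linarith [hD.2.1 x y])
    have h3 := hD'.abs_sub_le_mul_dist hD'K y x a b
    rw [hD'.2.1 y x] at h3
    linarith

/-- A continuous function on `[0, 1]` which is locally midpoint concave lies above its chord. -/
lemma mul_le_of_locally_midpoint_concave {φ : ℝ → ℝ} (hφ : ContinuousOn φ (Icc 0 1))
    (h0 : φ 0 = 0)
    (h : ∀ s ∈ Ioo (0 : ℝ) 1, ∃ η > 0, ∀ u, 0 < u → u ≤ η → 0 ≤ s - u → s + u ≤ 1 →
      φ (s + u) + φ (s - u) ≤ 2 * φ s) {s : ℝ} (hs : s ∈ Icc (0 : ℝ) 1) :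
    s * φ 1 ≤ φ s := by
  set ψ : ℝ → ℝ := fun s => φ s - s * φ 1 with hψdef
  have hψ : ContinuousOn ψ (Icc 0 1) := by fun_prop
  obtain ⟨m, hm, hmin⟩ := isCompact_Icc.exists_isMinOn ⟨0, by simp⟩ hψ
  by_contra! hlt
  have hneg : ψ m < 0 := (hmin hs).trans_lt (by simp only [hψdef]; linarith)
  have hcl : IsClosed (Icc (0 : ℝ) 1 ∩ ψ ⁻¹' {ψ m}) :=
    hψ.preimage_isClosed_of_isClosed isClosed_Icc isClosed_singleton
  obtain ⟨z, ⟨hz, hzm⟩, hleast⟩ :=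
    (isCompact_Icc.of_isClosed_subset hcl inter_subset_left).exists_isLeast ⟨m, hm, rfl⟩
  have hzm : ψ z = ψ m := hzm
  have hz0 : 0 < z := by
    refine lt_of_le_of_ne hz.1 ?_
    rintro rfl
    simp only [hψdef, h0] at hzm hneg
    linarith
  have hz1 : z < 1 := by
    refine lt_of_le_of_ne hz.2 ?_
    rintro rfl
    simp only [hψdef] at hzm hneg
    linarith
  obtain ⟨η, hη, hmid⟩ := h z ⟨hz0, hz1⟩
  set u := min η (min z (1 - z)) with hu
  have hu0 : 0 < u := lt_min hη (lt_min hz0 (by linarith))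
  have hu1 : u ≤ z := (min_le_right _ _).trans (min_le_left _ _)
  have hu2 : u ≤ 1 - z := (min_le_right _ _).trans (min_le_right _ _)
  have h1 := hmid u hu0 (min_le_left _ _) (by linarith) (by linarith)
  have h2 : ψ m ≤ ψ (z + u) := hmin ⟨by linarith, by linarith⟩
  have hmem : z - u ∈ Icc (0 : ℝ) 1 := ⟨by linarith, by linarith⟩
  have h3 : ψ m ≤ ψ (z - u) := hmin hmem
  have h4 : ψ m ≠ ψ (z - u) := fun he => by linarith [hleast ⟨hmem, he.symm⟩]
  have h5 := lt_of_le_of_ne h3 h4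
  simp only [hψdef] at h1 h2 h5 hzm
  linarith

end Basic

/-- `T` and `S` are mutually inverse isometries between `LPMlt k X` and `LPMlt k Y`. -/
structure IsIsometryPair {X Y : Type*} [MetricSpace X] [MetricSpace Y] (k : ℝ)
    (T : (X → X → ℝ) → (Y → Y → ℝ)) (S : (Y → Y → ℝ) → (X → X → ℝ)) : Prop where
  mapsTo : MapsTo T (LPMlt k X) (LPMlt k Y)
  mapsTo_inv : MapsTo S (LPMlt k Y) (LPMlt k X)
  left_inv : ∀ d ∈ LPMlt k X, S (T d) = d
  right_inv : ∀ e ∈ LPMlt k Y, T (S e) = e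
  isometry : ∀ d ∈ LPMlt k X, ∀ e ∈ LPMlt k X, supDist (T d) (T e) = supDist d e

namespace IsIsometryPair

variable {X Y : Type*} [MetricSpace X] [MetricSpace Y] {k : ℝ}
  {T : (X → X → ℝ) → (Y → Y → ℝ)} {S : (Y → Y → ℝ) → (X → X → ℝ)}

lemma symm (h : IsIsometryPair k T S) : IsIsometryPair k S T where
  mapsTo := h.mapsTo_inv
  mapsTo_inv := h.mapsTo
  left_inv := h.right_inv
  right_inv := h.left_inv
  isometry d hd e he := by
    rw [← h.isometry _ (h.mapsTo_inv hd) _ (h.mapsTo_inv he), h.right_inv d hd, h.right_inv e he]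

lemma map_zero [Nonempty X] [Nonempty Y] (h : IsIsometryPair k T S) (hk : 0 < k) :
    T (fun _ _ => 0) = fun _ _ => 0 := by
  have h0 : (fun _ _ => 0 : X → X → ℝ) ∈ LPMlt k X := zero_mem_LPMlt hk
  have h0' : (fun _ _ => 0 : Y → Y → ℝ) ∈ LPMlt k Y := zero_mem_LPMlt hk
  have hc := h.mapsTo h0
  have hSc := h.left_inv _ h0
  set c := T fun _ _ => 0
  obtain ⟨ε, hε, hε1, he⟩ := exists_one_add_mul_mem_LPMlt hk hc
  have he' : (fun x y => (1 - ε) * c x y) ∈ LPMlt k Y :=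
    const_mul_mem_LPMlt hk hc (by linarith) (by linarith)
  set N := supDist c fun _ _ => 0
  have hN (x y : Y) : c x y ≤ N := by
    simpa [abs_of_nonneg (hc.1.1.nonneg x y)] using abs_sub_le_supDist_of_mem hc h0' x y
  have hpos (x y : Y) : 0 ≤ c x y := hc.1.1.nonneg x y
  have key : supDist (fun x y => (1 + ε) * c x y) (fun x y => (1 - ε) * c x y) ≤ ε * N := by
    have b1 : supDist (fun x y => (1 + ε) * c x y) c ≤ ε * N := supDist_le fun x y => by
      rw [show (1 + ε) * c x y - c x y = ε * c x y by ring,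
        abs_of_nonneg (mul_nonneg hε.le (hpos x y))]
      exact mul_le_mul_of_nonneg_left (hN x y) hε.le
    have b2 : supDist (fun x y => (1 - ε) * c x y) c ≤ ε * N := supDist_le fun x y => by
      rw [show (1 - ε) * c x y - c x y = -(ε * c x y) by ring, abs_neg,
        abs_of_nonneg (mul_nonneg hε.le (hpos x y))]
      exact mul_le_mul_of_nonneg_left (hN x y) hε.le
    rw [← h.symm.isometry _ he _ hc, hSc] at b1
    rw [← h.symm.isometry _ he' _ hc, hSc] at b2
    rw [← h.symm.isometry _ he _ he']
    have m1 := h.mapsTo_inv he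
    have m2 := h.mapsTo_inv he'
    refine supDist_le fun x y => ?_
    have a1 := (le_abs_self _).trans ((abs_sub_le_supDist_of_mem m1 h0 x y).trans b1)
    have a2 := (le_abs_self _).trans ((abs_sub_le_supDist_of_mem m2 h0 x y).trans b2)
    have a3 := m1.1.1.nonneg x y
    have a4 := m2.1.1.nonneg x y
    rw [abs_le]
    constructor <;> linarith
  have hhalf (x y : Y) : c x y ≤ N / 2 := by
    have h1 := (le_abs_self _).trans ((abs_sub_le_supDist_of_mem he he' x y).trans key)
    have h2 : ε * (2 * c x y) ≤ ε * N := by linarith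
    linarith [le_of_mul_le_mul_left h2 hε]
  have hN0 : N ≤ N / 2 := supDist_le fun x y => by
    simpa [abs_of_nonneg (hpos x y)] using hhalf x y
  funext x y
  linarith [hpos x y, hN x y]

/-- To a pair `(a, b)` in `Y` and a base point `d` there corresponds, up to `ζ` and a sign, a pair
in `X` at which the increments from `d` dominate those of the images at `(a, b)`. -/
lemma exists_dominating_pair [Nonempty X] [Nonempty Y] (h : IsIsometryPair k T S)
    {K δ ζ : ℝ} (hK : 0 ≤ K) (hKk : K < k) (hδ : 0 < δ) (hζ : 0 < ζ)
    {d : X → X → ℝ} (hd : d ∈ LPMlt k X) (hdK : ∀ x y, T d x y ≤ K * dist x y) {a b : Y}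
    (hab : T d a b + δ ≤ K * dist a b) :
    ∃ f ∈ LPMlt k X, ∃ x y : X, ∃ σ : ℝ, (σ = 1 ∨ σ = -1) ∧ δ - ζ ≤ σ * (f x y - d x y) ∧
      ∀ d' ∈ LPMlt k X, (∀ x y, T d' x y ≤ K * dist x y) → (∀ x y, |d' x y - d x y| ≤ δ / 4) →
        T d' a b - T d a b - ζ ≤ σ * (d' x y - d x y) := by
  have hD := h.mapsTo hd
  obtain ⟨F, hF, hDF, hFD, hFab, hcone⟩ := exists_peak hK hKk hδ hD.1.1 hD.1.2.1 hdK hab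
  have hf := h.mapsTo_inv hF
  have hTf := h.right_inv F hF
  have hdist : δ ≤ supDist (S F) d := by
    rw [← h.isometry _ hf _ hd, hTf]
    refine le_trans ?_ (abs_sub_le_supDist_of_mem hF hD a b)
    rw [hFab, add_sub_cancel_left]
    exact le_abs_self δ
  obtain ⟨x, y, hxy⟩ := exists_lt_abs_sub (show δ - ζ < supDist (S F) d by linarith)
  obtain ⟨σ, hσ, hσabs⟩ : ∃ σ : ℝ, (σ = 1 ∨ σ = -1) ∧
      |S F x y - d x y| = σ * (S F x y - d x y) := by
    rcases abs_cases (S F x y - d x y) with ⟨h1, -⟩ | ⟨h1, -⟩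
    · exact ⟨1, Or.inl rfl, by linarith⟩
    · exact ⟨-1, Or.inr rfl, by linarith⟩
  refine ⟨S F, hf, x, y, σ, hσ, by linarith, fun d' hd' hd'K hclose => ?_⟩
  have hD' := h.mapsTo hd'
  have hclose' (x y : Y) : |T d' x y - T d x y| ≤ δ / 4 :=
    (abs_sub_le_supDist_of_mem hD' hD x y).trans
      ((h.isometry _ hd' _ hd).le.trans (supDist_le hclose))
  have hle : supDist F (T d') ≤ F a b - T d' a b := by
    refine supDist_le fun z w => ?_
    have h1 := abs_le.1 (hclose' z w)
    have h2 := abs_le.1 (hclose' a b)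
    have h3 := hDF z w
    rw [abs_le]
    rcases le_or_gt (F z w - T d z w) (δ / 2) with h4 | h4
    · constructor <;> linarith
    · have h5 := abs_le.1 (hcone z w h4 (T d') hD'.1.1 hd'K)
      constructor <;> linarith
  rw [← hTf, h.isometry _ hf _ hd', hTf] at hle
  have h6 := (abs_sub_le_supDist_of_mem hf hd' x y).trans hle
  have h7 : σ * (S F x y - d' x y) ≤ |S F x y - d' x y| := by
    rcases hσ with rfl | rfl
    · rw [one_mul]; exact le_abs_self _
    · rw [neg_one_mul]; exact neg_le_abs _
  linarith

lemma locally_midpoint_concave [Nonempty X] [Nonempty Y] (h : IsIsometryPair k T S) (hk : 0 < k)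
    {d : X → X → ℝ} (hd : d ∈ LPMlt k X) {a b : Y} (hab : a ≠ b) :
    ∃ η > 0, ∀ d₁ ∈ LPMlt k X, ∀ d₂ ∈ LPMlt k X, (∀ x y, |d₁ x y - d x y| ≤ η) →
      (∀ x y, d₁ x y + d₂ x y = 2 * d x y) → T d₁ a b + T d₂ a b ≤ 2 * T d a b := by
  have hD := h.mapsTo hd
  have hdist := dist_pos.2 hab
  obtain ⟨-, -, L, hL, hLk, hDL⟩ := (mem_LPMlt_iff hk).1 hD
  set δ := (k - L) / 2 * dist a b with hδdef
  have hδ : 0 < δ := mul_pos (by linarith) hdist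
  refine ⟨δ / 4, by positivity, fun d₁ hd₁ d₂ hd₂ hclose hsum => ?_⟩
  obtain ⟨K, hK₀, hK, hKk, hK₁, hK₂⟩ :=
    exists_common_lip hk (h.mapsTo hd₁) (h.mapsTo hd₂) (show (k + L) / 2 < k by linarith)
  have hclose₂ (x y : X) : |d₂ x y - d x y| ≤ δ / 4 := by
    rw [show d₂ x y - d x y = -(d₁ x y - d x y) by linarith [hsum x y], abs_neg]
    exact hclose x y
  have hDK (x y : Y) : T d x y ≤ K * dist x y :=
    (hDL x y).trans (mul_le_mul_of_nonneg_right (by linarith) dist_nonneg)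
  have habK : T d a b + δ ≤ K * dist a b := by
    have := mul_le_mul_of_nonneg_right hK₀ hdist.le
    linarith [hDL a b]
  refine le_of_forall_pos_le_add fun ζ hζ => ?_
  obtain ⟨-, -, x, y, σ, -, -, hdom⟩ :=
    h.exists_dominating_pair hK hKk hδ (half_pos hζ) hd hDK habK
  have h1 := hdom d₁ hd₁ hK₁ hclose
  have h2 := hdom d₂ hd₂ hK₂ hclose₂
  have h3 : σ * (d₁ x y - d x y) + σ * (d₂ x y - d x y) = 0 := by
    rw [← mul_add, show d₁ x y - d x y + (d₂ x y - d x y) = 0 by linarith [hsum x y], mul_zero]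
  linarith

lemma mul_map_le [Nonempty X] [Nonempty Y] (h : IsIsometryPair k T S) (hk : 0 < k)
    {d : X → X → ℝ} (hd : d ∈ LPMlt k X) {s : ℝ} (hs0 : 0 ≤ s) (hs1 : s ≤ 1) (a b : Y) :
    s * T d a b ≤ T (fun x y => s * d x y) a b := by
  have hmem {t : ℝ} (ht0 : 0 ≤ t) (ht1 : t ≤ 1) := const_mul_mem_LPMlt hk hd ht0 ht1
  rcases eq_or_ne a b with rfl | hab
  · rw [(h.mapsTo hd).1.1.1, (h.mapsTo (hmem hs0 hs1)).1.1.1, mul_zero]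
  obtain ⟨C, hC⟩ := hd.1.2.1
  have hpos (x y : X) : 0 ≤ d x y := hd.1.1.nonneg x y
  have hC0 : 0 ≤ C := by
    obtain ⟨x⟩ := ‹Nonempty X›
    exact (hpos x x).trans (hC x x)
  have hscale (t u : ℝ) (x y : X) : |t * d x y - u * d x y| ≤ C * |t - u| := by
    rw [← sub_mul, abs_mul, abs_of_nonneg (hpos x y), mul_comm]
    exact mul_le_mul_of_nonneg_right (hC x y) (abs_nonneg _)
  have hone : (fun x y => 1 * d x y) = d := by simp
  have hcont : ContinuousOn (fun t : ℝ => T (fun x y => t * d x y) a b) (Icc 0 1) := by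
    refine (LipschitzOnWith.of_dist_le_mul (K := C.toNNReal) fun t ht u hu => ?_).continuousOn
    rw [Real.dist_eq, Real.dist_eq, Real.coe_toNNReal _ hC0]
    refine (abs_sub_le_supDist_of_mem (h.mapsTo (hmem ht.1 ht.2))
      (h.mapsTo (hmem hu.1 hu.2)) a b).trans ?_
    rw [h.isometry _ (hmem ht.1 ht.2) _ (hmem hu.1 hu.2)]
    exact supDist_le (hscale t u)
  have key := mul_le_of_locally_midpoint_concave hcont
    (by simp only [zero_mul, h.map_zero hk]) (fun t ht => ?_) ⟨hs0, hs1⟩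
  · simpa only [hone] using key
  obtain ⟨η, hη, hmid⟩ := h.locally_midpoint_concave hk (hmem ht.1.le ht.2.le) hab
  have hpos' : 0 < C + 1 := by linarith
  refine ⟨η / (C + 1), by positivity, fun u hu huη hl hr => ?_⟩
  refine hmid _ (hmem (by linarith [ht.1]) hr) _ (hmem hl (by linarith [ht.2])) (fun x y => ?_)
    fun x y => by ring
  refine (hscale _ _ x y).trans ?_
  rw [add_sub_cancel_left, abs_of_pos hu]
  rw [le_div_iff₀ hpos'] at huη
  linarith

/-- A base point `0` version of `exists_dominating_pair`, where the sign is positive. -/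
lemma exists_dominating_pair_zero [Nonempty X] [Nonempty Y] (h : IsIsometryPair k T S)
    (hk : 0 < k) {K δ ζ : ℝ} (hK : 0 ≤ K) (hKk : K < k) (hζ : 0 < ζ) (hζδ : ζ < δ)
    {a b : Y} (hab : δ ≤ K * dist a b) :
    ∃ x y : X, δ - ζ ≤ k * dist x y ∧
      ∀ d ∈ LPMlt k X, (∀ x y, T d x y ≤ K * dist x y) → (∀ x y, d x y ≤ δ / 4) →
        T d a b - ζ ≤ d x y := by
  have h0 := h.map_zero hk
  obtain ⟨f, hf, x, y, σ, hσ, hfσ, hdom⟩ := h.exists_dominating_pair hK hKk (hζ.trans hζδ) hζ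
    (zero_mem_LPMlt hk) (a := a) (b := b)
    (by intro x y; rw [h0]; exact mul_nonneg hK dist_nonneg) (by rw [h0]; simpa using hab)
  have hfpos := hf.1.1.nonneg x y
  obtain rfl : σ = 1 := by
    refine hσ.resolve_right ?_
    rintro rfl
    linarith
  have hfle := LPMlt_le_mul_dist hk hf x y
  refine ⟨x, y, by linarith, fun d hd hdK hsmall => ?_⟩
  have := hdom d hd hdK fun x y => by
    rw [sub_zero, abs_of_nonneg (hd.1.1.nonneg x y)]; exact hsmall x y
  rw [h0] at this
  linarith

lemma map_le_supDist_zero [Nonempty X] [Nonempty Y] (h : IsIsometryPair k T S) (hk : 0 < k)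
    {d : X → X → ℝ} (hd : d ∈ LPMlt k X) (x y : Y) : T d x y ≤ supDist d fun _ _ => 0 := by
  have h1 := abs_sub_le_supDist_of_mem (h.mapsTo hd) (h.mapsTo (zero_mem_LPMlt hk)) x y
  rw [h.isometry _ hd _ (zero_mem_LPMlt hk), h.map_zero hk] at h1
  linarith [le_abs_self (T d x y - 0)]

lemma map_mul_le_of_small [Nonempty X] [Nonempty Y] (h : IsIsometryPair k T S) (hk : 0 < k)
    {d : X → X → ℝ} (hd : d ∈ LPMlt k X) {a b : Y} (hab : a ≠ b) :
    ∃ s₀ > 0, ∀ s, 0 < s → s ≤ s₀ → T (fun x y => s * d x y) a b ≤ s * T d a b := by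
  have hdist := dist_pos.2 hab
  set δ := k / 2 * dist a b with hδdef
  have hδ : 0 < δ := by positivity
  set N := supDist d fun _ _ => 0 with hNdef
  have hdN (x y : X) : d x y ≤ N := by
    have := abs_sub_le_supDist_of_mem hd (zero_mem_LPMlt hk) x y
    linarith [le_abs_self (d x y - 0)]
  have hDN (x y : Y) : T d x y ≤ N := h.map_le_supDist_zero hk hd x y
  have hD := h.mapsTo hd
  have hN0 : 0 ≤ N := (hD.1.1.nonneg a a).trans (hDN a a)
  refine ⟨min (1 / 2) (δ / 16 / (N + 1)), by positivity, fun s hs hs₀ => ?_⟩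
  have hs1 : s ≤ 1 / 2 := hs₀.trans (min_le_left _ _)
  have hsN : s * N ≤ δ / 16 := by
    have := hs₀.trans (min_le_right _ _)
    rw [le_div_iff₀ (by linarith)] at this
    linarith
  have hsd := const_mul_mem_LPMlt hk hd hs.le (by linarith)
  have hsD := const_mul_mem_LPMlt hk hD hs.le (by linarith)
  have hsdN (x y : X) : s * d x y ≤ δ / 16 :=
    (mul_le_mul_of_nonneg_left (hdN x y) hs.le).trans hsN
  have hsDN (x y : Y) : s * T d x y ≤ δ / 16 :=
    (mul_le_mul_of_nonneg_left (hDN x y) hs.le).trans hsN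
  obtain ⟨E, hE, -, hEle, hEab, hcone⟩ := exists_peak (Z := Y) (k := k) (K := k / 2) (δ := δ / 16)
    (by linarith) (by linarith) (by linarith) (zero_mem_LPMlt hk).1.1 (zero_mem_LPMlt hk).1.2.1
    (fun x y => by positivity) (a := a) (b := b) (by linarith)
  simp only [zero_add, sub_zero] at hEle hEab hcone
  have hSE := h.mapsTo_inv hE
  have hSEle (x y : X) : S E x y ≤ δ / 16 :=
    (h.symm.map_le_supDist_zero hk hE x y).trans <| supDist_le fun x y => by
      rw [sub_zero, abs_of_nonneg (hE.1.1.nonneg x y)]; exact hEle x y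
  obtain ⟨K, hK₀, hK, hKk, hK₁, hK₂⟩ :=
    exists_common_lip hk (h.mapsTo hsd) hE (show k / 2 < k by linarith)
  obtain ⟨K', hK'₀, hK', hK'k, hK'₁, hK'₂⟩ :=
    exists_common_lip hk (h.mapsTo_inv hsD) hSE (show k / 2 < k by linarith)
  refine le_of_forall_pos_le_add fun ξ hξ => ?_
  set ζ := min (ξ / 4) (δ / 128) with hζdef
  have hζ : 0 < ζ := by positivity
  have hζξ : ζ ≤ ξ / 4 := min_le_left _ _
  have hζδ : ζ ≤ δ / 128 := min_le_right _ _
  obtain ⟨x, y, hxy, hdom⟩ := h.exists_dominating_pair_zero hk hK hKk hζ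
    (show ζ < δ by linarith) (a := a) (b := b) (mul_le_mul_of_nonneg_right hK₀ hdist.le)
  have h1 := hdom _ hsd hK₁ fun x y => by linarith [hsdN x y]
  have h2 := hdom _ hSE (by rwa [h.right_inv E hE]) fun x y => by linarith [hSEle x y]
  rw [h.right_inv E hE, hEab] at h2
  have h3 := h.symm.mul_map_le hk hD hs.le (by linarith) x y
  rw [h.left_inv d hd] at h3
  obtain ⟨a', b', -, hdom'⟩ := h.symm.exists_dominating_pair_zero hk hK' hK'k hζ
    (show ζ < δ / 4 by linarith) (a := x) (b := y)
    (by linarith [mul_le_mul_of_nonneg_right hK'₀ (dist_nonneg (x := x) (y := y))])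
  have h4 := hdom' _ hsD hK'₁ fun x y => by linarith [hsDN x y]
  have h5 := hdom' _ hE hK'₂ fun x y => by linarith [hEle x y]
  have h6 := hcone a' b' (by linarith) _ hsD.1.1 fun x y => by
    have := mul_le_mul hs1 (LPMlt_le_mul_dist hk hD x y) (hD.1.1.nonneg x y) (by norm_num)
    linarith
  have h7 := (le_abs_self _).trans h6
  linarith

lemma map_mul_of_le_one [Nonempty X] [Nonempty Y] (h : IsIsometryPair k T S) (hk : 0 < k)
    {d : X → X → ℝ} (hd : d ∈ LPMlt k X) {t : ℝ} (ht0 : 0 < t) (ht1 : t ≤ 1) :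
    T (fun x y => t * d x y) = fun x y => t * T d x y := by
  have htd := const_mul_mem_LPMlt hk hd ht0.le ht1
  funext a b
  rcases eq_or_ne a b with rfl | hab
  · rw [(h.mapsTo hd).1.1.1, (h.mapsTo htd).1.1.1, mul_zero]
  refine le_antisymm ?_ (h.mul_map_le hk hd ht0.le ht1 a b)
  obtain ⟨s₀, hs₀, hsmall⟩ := h.map_mul_le_of_small hk hd hab
  set r := min 1 (s₀ / t) with hr
  have hr0 : 0 < r := by positivity
  have hrt : r * t ≤ s₀ := by
    rw [← le_div_iff₀ ht0]; exact min_le_right _ _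
  have h1 := hsmall (r * t) (by positivity) hrt
  have h2 := h.mul_map_le hk htd hr0.le (min_le_left _ _) a b
  simp only [← mul_assoc] at h2
  have h3 := h2.trans h1
  rw [mul_assoc] at h3
  exact le_of_mul_le_mul_left h3 hr0

end IsIsometryPair

theorem stmt11 {X Y : Type*} [MetricSpace X] [MetricSpace Y]
    [Nontrivial X] [Nontrivial Y] (k : ℝ) (hk : 0 < k)
    (T : (X → X → ℝ) → (Y → Y → ℝ))
    (hbij : Set.BijOn T (LPMlt k X) (LPMlt k Y))
    (hiso : ∀ d ∈ LPMlt k X, ∀ e ∈ LPMlt k X, supDist (T d) (T e) = supDist d e) :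
    ∀ d ∈ LPMlt k X, ∀ t : ℝ, 0 ≤ t →
      (fun x y => t * d x y) ∈ LPMlt k X →
      T (fun x y => t * d x y) = fun x y => t * T d x y := by
  have hinv := hbij.invOn_invFunOn
  have h : IsIsometryPair k T (Function.invFunOn T (LPMlt k X)) :=
    ⟨hbij.mapsTo, hbij.surjOn.mapsTo_invFunOn, fun d hd => hinv.1 hd, fun e he => hinv.2 he, hiso⟩
  intro d hd t ht htd
  rcases ht.eq_or_lt with rfl | ht0
  · simpa only [zero_mul] using h.map_zero hk
  rcases le_total t 1 with ht1 | ht1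
  · exact h.map_mul_of_le_one hk hd ht0 ht1
  · have key := h.map_mul_of_le_one hk htd (inv_pos.2 ht0) (inv_le_one_of_one_le₀ ht1)
    simp only [inv_mul_cancel_left₀ ht0.ne'] at key
    rw [key]
    simp only [mul_inv_cancel_left₀ ht0.ne']

end BanachStone
end

section
/- Let (Z,d_Z) be a metric space with at least two points, let d ∈ LPM(Z,d_Z), and let x, y ∈ Z be distinct points. Then there exists a bounded Lipschitz continuous metric ρ ∈ LPM(Z,d_Z) (so ρ(z,w) > 0 whenever z ≠ w) such that for every pair (z,w) ∈ Z × Z with (z,w) ≠ (x,y) and (z,w) ≠ (y,x), one has ρ(x,y) ≥ ρ(z,w) and d(x,y) + ρ(x,y) > d(z,w) + ρ(z,w); in particular d + ρ ∈ LPM(Z,d_Z). -/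
open Set Filter

namespace BanachStone

theorem lip_lt_top_iff {Z : Type*} [MetricSpace Z] {d : Z → Z → ℝ} (h0 : ∀ z, d z z = 0) :
    lip d < ⊤ ↔ ∃ L : ℝ, 0 ≤ L ∧ ∀ z w, d z w ≤ L * dist z w := by
  constructor
  · intro h
    refine ⟨(lip d).toReal, ENNReal.toReal_nonneg, fun z w => ?_⟩
    rcases eq_or_ne z w with rfl | hzw
    · simp [h0]
    · have hle : ENNReal.ofReal (d z w / dist z w) ≤ lip d :=
        le_iSup_of_le z (le_iSup_of_le w (le_iSup_of_le hzw le_rfl))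
      rw [← div_le_iff₀ (dist_pos.2 hzw)]
      exact (ENNReal.ofReal_le_iff_le_toReal h.ne).1 hle
  · rintro ⟨L, -, hL⟩
    refine lt_of_le_of_lt ?_ (ENNReal.ofReal_lt_top (r := L))
    refine iSup_le fun z => iSup_le fun w => iSup_le fun hzw => ENNReal.ofReal_le_ofReal ?_
    rw [div_le_iff₀ (dist_pos.2 hzw)]
    exact hL z w

theorem add_mem_LPM {Z : Type*} [MetricSpace Z] {d ρ : Z → Z → ℝ} (hd : d ∈ LPM Z)
    (hρ : ρ ∈ LPM Z) : (fun z w => d z w + ρ z w) ∈ LPM Z := by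
  obtain ⟨⟨d0, ds, dt⟩, ⟨C, hC⟩, hL⟩ := hd
  obtain ⟨⟨r0, rs, rt⟩, ⟨D, hD⟩, hK⟩ := hρ
  obtain ⟨L, L0, hL⟩ := (lip_lt_top_iff d0).1 hL
  obtain ⟨K, K0, hK⟩ := (lip_lt_top_iff r0).1 hK
  have h0 : ∀ z, d z z + ρ z z = 0 := fun z => by rw [d0, r0, add_zero]
  refine ⟨⟨h0, fun z w => by simp only [ds z w, rs z w],
    fun z w v => by linarith [dt z w v, rt z w v]⟩,
    ⟨C + D, fun z w => add_le_add (hC z w) (hD z w)⟩,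
    (lip_lt_top_iff (d := fun z w => d z w + ρ z w) h0).2 ⟨L + K, by positivity, fun z w => ?_⟩⟩
  linarith [hL z w, hK z w]

/-- The truncation of the ambient metric at a nonnegative height is a bounded Lipschitz pseudometric. -/
theorem min_dist_mem_LPM {Z : Type*} [MetricSpace Z] {r : ℝ} (hr : 0 ≤ r) :
    (fun z w : Z => min (dist z w) r) ∈ LPM Z := by
  have h0 : ∀ z : Z, min (dist z z) r = 0 := fun z => by simp [hr]
  refine ⟨⟨h0, fun z w => by simp only [dist_comm], fun z w v => ?_⟩,
    ⟨r, fun z w => min_le_right _ _⟩,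
    (lip_lt_top_iff (d := fun z w : Z => min (dist z w) r) h0).2
      ⟨1, zero_le_one, fun z w => by simp⟩⟩
  have := dist_triangle z w v
  have h1 : 0 ≤ dist z w := dist_nonneg
  have h2 : 0 ≤ dist w v := dist_nonneg
  rcases min_cases (dist z w) r with h | h <;> rcases min_cases (dist w v) r with h' | h' <;>
    rcases min_cases (dist z v) r with h'' | h'' <;> linarith

/-- A bounded Lipschitz function induces a bounded Lipschitz pseudometric. -/
theorem abs_sub_mem_LPM {Z : Type*} [MetricSpace Z] {f : Z → ℝ} {B K : ℝ} (hK : 0 ≤ K)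
    (hB : ∀ z, |f z| ≤ B) (hf : ∀ z w, f z - f w ≤ K * dist z w) :
    (fun z w => |f z - f w|) ∈ LPM Z := by
  have h0 : ∀ z, |f z - f z| = 0 := fun z => by simp
  refine ⟨⟨h0, fun z w => abs_sub_comm _ _, fun z w v => abs_sub_le _ _ _⟩,
    ⟨B + B, fun z w => (abs_sub _ _).trans (add_le_add (hB z) (hB w))⟩,
    (lip_lt_top_iff (d := fun z w => |f z - f w|) h0).2
      ⟨K, hK, fun z w => abs_sub_le_iff.2 ⟨hf z w, ?_⟩⟩⟩
  rw [dist_comm]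
  exact hf w z

/-- The cone of height and radius `s` with apex over `a`. -/
noncomputable def cone {Z : Type*} [MetricSpace Z] (s : ℝ) (a z : Z) : ℝ := max 0 (s - dist z a)

section cone

variable {Z : Type*} [MetricSpace Z] {s : ℝ} (a z w : Z)

theorem cone_nonneg : 0 ≤ cone s a z := le_max_left _ _

theorem cone_le (hs : 0 ≤ s) : cone s a z ≤ s :=
  max_le hs (sub_le_self _ dist_nonneg)

theorem cone_sub_cone_le : cone s a z - cone s a w ≤ dist z w := by
  rw [sub_le_iff_le_add]
  refine max_le (add_nonneg dist_nonneg (cone_nonneg a w)) ?_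
  have h : s - dist w a ≤ cone s a w := le_max_right _ _
  linarith [dist_triangle w z a, dist_comm z w]

theorem cone_eq_zero_or : cone s a z = 0 ∨ cone s a z = s - dist z a := max_choice _ _

end cone

/-- Adding a suitable bounded Lipschitz pseudometric makes `d` attain its strict maximum at a
prescribed pair of distinct points. -/
theorem exists_LPM_strict_peak {Z : Type*} [MetricSpace Z] {d : Z → Z → ℝ} (hd : d ∈ LPM Z)
    {x y : Z} (hxy : x ≠ y) :
    ∃ σ ∈ LPM Z, ∀ z w : Z, (z, w) ≠ (x, y) → (z, w) ≠ (y, x) →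
      σ z w ≤ σ x y ∧ d z w + σ z w < d x y + σ x y := by
  obtain ⟨⟨d0, ds, dt⟩, ⟨C, hC⟩, hL⟩ := hd
  obtain ⟨L, L0, hL⟩ := (lip_lt_top_iff d0).1 hL
  have C0 : 0 ≤ C := (d0 x).symm.trans_le (hC x x)
  have dxy0 : 0 ≤ d x y := by linarith [dt x y x, d0 x, ds x y]
  obtain ⟨s, hs, hsr⟩ : ∃ s : ℝ, 0 < s ∧ s ≤ dist x y := ⟨dist x y, dist_pos.2 hxy, le_rfl⟩
  obtain ⟨M, hML, hMC⟩ : ∃ M : ℝ, L < M ∧ C < M * s := by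
    refine ⟨L + (C + 1) / s, by linarith [show 0 < (C + 1) / s by positivity], ?_⟩
    rw [add_mul, div_mul_cancel₀ _ hs.ne']
    nlinarith
  have M0 : 0 < M := L0.trans_lt hML
  set f : Z → ℝ := fun z => M * (cone s x z - cone s y z) with hf
  have hfle : ∀ z, |f z| ≤ M * s := fun z => by
    rw [hf]
    simp only [abs_mul, abs_of_pos M0]
    refine mul_le_mul_of_nonneg_left (abs_sub_le_iff.2 ⟨?_, ?_⟩) M0.le <;>
      linarith [cone_nonneg (s := s) x z, cone_nonneg (s := s) y z,
        cone_le x z hs.le, cone_le y z hs.le]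
  have hfx : f x = M * s := by
    simp [hf, cone, hs.le, hsr]
  have hfy : f y = -(M * s) := by
    simp [hf, cone, hs.le, dist_comm y x, hsr]
  have hfxy : |f x - f y| = M * s + M * s := by
    rw [hfx, hfy, sub_neg_eq_add, abs_of_pos (by positivity)]
  have key : ∀ z w, (z, w) ≠ (x, y) → d z w + (f z - f w) < d x y + (M * s + M * s) := by
    intro z w hne
    have hdist : 0 < dist z x + dist w y := by
      by_contra! h
      have hzx : 0 ≤ dist z x := dist_nonneg
      have hwy : 0 ≤ dist w y := dist_nonneg
      have h1 : dist z x = 0 := by linarith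
      have h2 : dist w y = 0 := by linarith
      exact hne (by rw [dist_eq_zero.1 h1, dist_eq_zero.1 h2])
    have hz := abs_le.1 (hfle z)
    have hw := abs_le.1 (hfle w)
    have hyz := mul_nonneg M0.le (cone_nonneg (s := s) y z)
    have hxw := mul_nonneg M0.le (cone_nonneg (s := s) x w)
    have hfz : f z = M * cone s x z - M * cone s y z := mul_sub _ _ _
    have hfw : f w = M * cone s x w - M * cone s y w := mul_sub _ _ _
    rcases cone_eq_zero_or (s := s) x z with h | h
    · rw [h] at hfz
      linarith [hC z w]
    rcases cone_eq_zero_or (s := s) y w with h' | h'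
    · rw [h'] at hfw
      linarith [hC z w]
    rw [h] at hfz
    rw [h'] at hfw
    have hlt := mul_lt_mul_of_pos_right hML hdist
    linarith [dt z x w, dt x y w, hL z x, hL w y, ds w y]
  refine ⟨fun z w => |f z - f w|, abs_sub_mem_LPM (K := M * 2) (by positivity) hfle
    fun z w => ?_, fun z w h1 h2 => ?_⟩
  · rw [hf]
    simp only [← mul_sub, mul_assoc]
    refine mul_le_mul_of_nonneg_left ?_ M0.le
    linarith [cone_sub_cone_le (s := s) x z w, cone_sub_cone_le (s := s) y w z, dist_comm z w]
  · simp only [hfxy]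
    refine ⟨(abs_sub _ _).trans (add_le_add (hfle z) (hfle w)), ?_⟩
    have hzw := key z w h1
    have hwz := key w z fun h => h2 (by simp_all)
    rw [ds w z] at hwz
    rcases abs_cases (f z - f w) with h | h <;> linarith

theorem stmt13 {Z : Type*} [MetricSpace Z] [Nontrivial Z]
    (d : Z → Z → ℝ) (hd : d ∈ LPM Z) (x y : Z) (hxy : x ≠ y) :
    ∃ ρ ∈ LPM Z, (∀ z w : Z, z ≠ w → 0 < ρ z w) ∧
      (∀ z w : Z, (z, w) ≠ (x, y) → (z, w) ≠ (y, x) →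
        ρ z w ≤ ρ x y ∧ d z w + ρ z w < d x y + ρ x y) ∧
      (fun z w => d z w + ρ z w) ∈ LPM Z := by
  obtain ⟨σ, hσ, hpeak⟩ := exists_LPM_strict_peak hd hxy
  have hr : 0 < dist x y := dist_pos.2 hxy
  have hρ := add_mem_LPM hσ (min_dist_mem_LPM (Z := Z) hr.le)
  refine ⟨_, hρ, fun z w hzw => ?_, fun z w h1 h2 => ?_, add_mem_LPM hd hρ⟩
  · obtain ⟨⟨s0, ss, st⟩, -⟩ := hσ
    have hpos : 0 < min (dist z w) (dist x y) := lt_min (dist_pos.2 hzw) hr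
    linarith [st z w z, s0 z, ss z w]
  · obtain ⟨hle, hlt⟩ := hpeak z w h1 h2
    have hmin : min (dist z w) (dist x y) ≤ dist x y := min_le_right _ _
    simp only [min_self]
    constructor <;> linarith

end BanachStone
end
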